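/- arXiv:math/9909185 — 9 statements merged into one kernel-verified Lean document; each statement's English description precedes it below -/
import Mathlib

section
/- Let Γ be a finite connected simple graph on v ≥ 2 vertices and suppose g is a scale-t embedding of Γ into the n-cube (t ≥ 1) such that for every coordinate i ∈ Fin n there exist vertices x, y with g(x)_i ≠ g(y)_i (no coordinate is constant). Then n·(v−1) ≤ t·W(Γ), where W(Γ) is the Wiener number of Γ. -/
/-- `g` is a scale-`t` embedding of the graph `G` into the `n`-cube: the Hamming
distance between images equals `t` times the graph distance. -/
def IsScaleEmbedding {V : Type*} [Fintype V] (G : SimpleGraph V) (t n : ℕ)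
    (g : V → (Fin n → Bool)) : Prop :=
  ∀ x y : V, hammingDist (g x) (g y) = t * G.dist x y

/-- The Wiener number of a graph: the sum of the graph distances over all
unordered pairs of vertices. -/
noncomputable def wiener {V : Type*} [Fintype V] (G : SimpleGraph V) : ℕ :=
  ∑ p ∈ Finset.univ.sym2,
    Sym2.lift ⟨fun x y => G.dist x y, fun _ _ => G.dist_comm⟩ p

/-- The indicator that a Boolean function `f` separates an unordered pair. -/
def separates {V : Type*} (f : V → Bool) : Sym2 V → ℕ :=
  Sym2.lift ⟨fun x y => if f x ≠ f y then 1 else 0, fun x y => by simp only [ne_comm]⟩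

/-- A nonconstant Boolean function on a finite type separates at least as many unordered pairs
as a spanning tree has edges. -/
theorem card_sub_one_le_sum_separates {V : Type*} [Fintype V] (f : V → Bool)
    (hf : ∃ x y : V, f x ≠ f y) :
    Fintype.card V - 1 ≤ ∑ p ∈ Finset.univ.sym2, separates f p := by
  classical
  obtain ⟨x, y, hxy⟩ := hf
  let e : V → Sym2 V := fun z => if f z = f x then s(z, y) else s(z, x)
  have he : Set.InjOn e (Finset.univ.erase x : Finset V) := by
    intro z hz w hw h
    simp only [Finset.coe_erase, Finset.coe_univ, Set.mem_sdiff, Set.mem_univ, true_and,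
      Set.mem_singleton_iff] at hz hw
    simp only [e] at h
    split_ifs at h <;> simp only [Sym2.eq_iff] at h <;> grind
  calc Fintype.card V - 1 = ∑ z ∈ Finset.univ.erase x, separates f (e z) := by
        rw [Finset.sum_congr rfl (g := fun _ => 1)]
        · simp
        · intro z _
          simp only [e, separates]
          split_ifs with h <;> simp [h, hxy]
    _ = ∑ p ∈ (Finset.univ.erase x).image e, separates f p :=
        (Finset.sum_image (f := separates f) he).symm
    _ ≤ ∑ p ∈ Finset.univ.sym2, separates f p :=
        Finset.sum_le_sum_of_subset (by simp)

/-- Under a scale embedding, the scaled Wiener number counts the pairs separated by each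
coordinate. -/
theorem IsScaleEmbedding.mul_wiener_eq {V : Type*} [Fintype V] {G : SimpleGraph V} {t n : ℕ}
    {g : V → (Fin n → Bool)} (hg : IsScaleEmbedding G t n g) :
    t * wiener G = ∑ i, ∑ p ∈ Finset.univ.sym2, separates (fun x => g x i) p := by
  rw [wiener, Finset.mul_sum, Finset.sum_comm]
  refine Finset.sum_congr rfl fun p _ => ?_
  induction p with
  | _ x y =>
    simp only [separates, Sym2.lift_mk, ← hg x y, hammingDist, Finset.card_filter]

/-- If `g` is a scale-`t` embedding of a connected graph `Γ` on `v ≥ 2` vertices into the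
`n`-cube with no constant coordinate, then `n·(v−1) ≤ t·W(Γ)`. -/
theorem le_wiener_of_scale_embedding {V : Type*} [Fintype V] (G : SimpleGraph V)
    (hconn : G.Connected) (v t n : ℕ) (hv : Fintype.card V = v) (hv2 : 2 ≤ v)
    (ht : 1 ≤ t) (g : V → (Fin n → Bool)) (hg : IsScaleEmbedding G t n g)
    (hnc : ∀ i : Fin n, ∃ x y : V, g x i ≠ g y i) :
    n * (v - 1) ≤ t * wiener G := by
  subst hv
  rw [hg.mul_wiener_eq]
  calc n * (Fintype.card V - 1) = ∑ _i : Fin n, (Fintype.card V - 1) := by simp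
    _ ≤ _ := Finset.sum_le_sum fun i _ => card_sub_one_le_sum_separates _ (hnc i)
end

section
/- For every v ≥ 2 the complete graph K_v admits an equicut scale-t embedding into the n-cube for some t ≥ 1 and n with n·⌈v/2⌉ = t·(2·⌈v/2⌉ − 1); in particular K_v is an equicut graph of size 2 − 1/⌈v/2⌉. -/
/-- An embedding `g` of a graph on vertex set `V` into the `n`-cube is *equicut* if
every coordinate takes the value `true` on `⌊v/2⌋` or `⌈v/2⌉` vertices, where
`v = |V|`. -/
def IsEquicut {V : Type*} [Fintype V] [DecidableEq V] (n : ℕ)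
    (g : V → (Fin n → Bool)) : Prop :=
  ∀ i : Fin n, (Finset.univ.filter (fun x : V => g x i = true)).card = Fintype.card V / 2 ∨
    (Finset.univ.filter (fun x : V => g x i = true)).card = (Fintype.card V + 1) / 2

/-- The number of permutations `σ` of `Fin (2 * k)` for which exactly one of `σ x`, `σ y`
lies in the lower half. -/
def sepCount (k : ℕ) (x y : Fin (2 * k)) : ℕ :=
  (Finset.univ.filter fun σ : Equiv.Perm (Fin (2 * k)) =>
    ¬ ((σ x).val < k ↔ (σ y).val < k)).card

theorem card_filter_val_lt_half (k : ℕ) :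
    (Finset.univ.filter fun z : Fin (2 * k) => z.val < k).card = k := by
  rw [Fin.card_filter_val_lt]; omega

theorem card_filter_not_val_lt_half (k : ℕ) :
    (Finset.univ.filter fun z : Fin (2 * k) => ¬ z.val < k).card = k := by
  have h := Finset.card_filter_add_card_filter_not (s := (Finset.univ : Finset (Fin (2 * k))))
    (fun z => z.val < k)
  rw [card_filter_val_lt_half, Finset.card_univ, Fintype.card_fin] at h
  omega

theorem sepCount_apply_apply (k : ℕ) (τ : Equiv.Perm (Fin (2 * k))) (x y : Fin (2 * k)) :
    sepCount k (τ x) (τ y) = sepCount k x y := by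
  unfold sepCount
  refine Finset.card_equiv (Equiv.mulRight τ) fun σ => ?_
  simp

theorem sepCount_self (k : ℕ) (x : Fin (2 * k)) : sepCount k x x = 0 := by
  simp [sepCount]

theorem sepCount_eq_of_ne {k : ℕ} {a b x y : Fin (2 * k)} (hab : a ≠ b) (hxy : x ≠ y) :
    sepCount k x y = sepCount k a b := by
  obtain ⟨τ, h1, h2⟩ := MulAction.is_two_pretransitive_iff.mp
    (Equiv.Perm.isMultiplyPretransitive (Fin (2 * k)) 2) hab hxy
  rw [← h1, ← h2]
  exact sepCount_apply_apply k τ a b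

theorem sum_sepCount (k : ℕ) (x : Fin (2 * k)) :
    ∑ y, sepCount k x y = Fintype.card (Equiv.Perm (Fin (2 * k))) * k := by
  unfold sepCount
  simp only [Finset.card_filter]
  rw [Finset.sum_comm]
  have key (σ : Equiv.Perm (Fin (2 * k))) :
      (∑ y, if ¬ ((σ x).val < k ↔ (σ y).val < k) then 1 else 0) = k := by
    rw [Equiv.sum_comp σ (fun y => if ¬ ((σ x).val < k ↔ y.val < k) then 1 else 0),
      ← Finset.card_filter]
    by_cases h : (σ x).val < k
    · simpa only [h, true_iff] using card_filter_not_val_lt_half k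
    · simpa only [h, false_iff, not_not] using card_filter_val_lt_half k
  rw [Finset.sum_congr rfl fun σ _ => key σ]
  simp

theorem card_perm_mul_eq_sepCount_mul {k : ℕ} {a b : Fin (2 * k)} (hab : a ≠ b) :
    Fintype.card (Equiv.Perm (Fin (2 * k))) * k = sepCount k a b * (2 * k - 1) := by
  rw [← sum_sepCount k a, ← Finset.add_sum_erase _ _ (Finset.mem_univ a), sepCount_self,
    Finset.sum_congr rfl fun y hy => sepCount_eq_of_ne hab (Finset.ne_of_mem_erase hy).symm]
  simp [mul_comm]

theorem card_filter_comp_le {α β : Type*} [Fintype α] [Fintype β] {f : α → β}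
    (hf : Function.Injective f) (p : β → Prop) [DecidablePred p] :
    (Finset.univ.filter fun x => p (f x)).card ≤ (Finset.univ.filter p).card :=
  Finset.card_le_card_of_injOn f (by intro x hx; simpa using hx) hf.injOn

/-- For every `v ≥ 2`, the complete graph `K_v` admits an equicut scale-`t` embedding
into the `n`-cube for some `t ≥ 1` and `n` with `n·⌈v/2⌉ = t·(2⌈v/2⌉ − 1)`; that is,
`K_v` is an equicut graph of size `2 − 1/⌈v/2⌉`. -/
theorem completeGraph_equicut (v : ℕ) (hv : 2 ≤ v) :
    ∃ (t n : ℕ) (g : Fin v → (Fin n → Bool)), 1 ≤ t ∧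
      IsScaleEmbedding (⊤ : SimpleGraph (Fin v)) t n g ∧ IsEquicut n g ∧
      n * ((v + 1) / 2) = t * (2 * ((v + 1) / 2) - 1) := by
  obtain ⟨k, hk⟩ : ∃ k, k = (v + 1) / 2 := ⟨_, rfl⟩
  rw [← hk]
  have hvk : v ≤ 2 * k := by omega
  let e := Fintype.equivFin (Equiv.Perm (Fin (2 * k)))
  let a : Fin (2 * k) := ⟨0, by omega⟩
  let b : Fin (2 * k) := ⟨1, by omega⟩
  have hab : a ≠ b := by simp [a, b]
  have hsize := card_perm_mul_eq_sepCount_mul hab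
  refine ⟨sepCount k a b, _, fun x i => decide ((e.symm i (Fin.castLE hvk x)).val < k),
    ?_, ?_, ?_, hsize⟩
  · by_contra! h
    have h0 : sepCount k a b = 0 := by omega
    rw [h0, zero_mul] at hsize
    have hn : Fintype.card (Equiv.Perm (Fin (2 * k))) ≠ 0 := Fintype.card_ne_zero
    rcases Nat.mul_eq_zero.mp hsize with h | h
    · exact hn h
    · omega
  · intro x y
    have hd : hammingDist
        (fun i => decide ((e.symm i (Fin.castLE hvk x)).val < k))
        (fun i => decide ((e.symm i (Fin.castLE hvk y)).val < k)) =
        sepCount k (Fin.castLE hvk x) (Fin.castLE hvk y) := by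
      unfold hammingDist sepCount
      refine Finset.card_equiv e.symm fun i => ?_
      simp only [Finset.mem_filter_univ, ne_eq, decide_eq_decide]
    rw [hd]
    rcases eq_or_ne x y with rfl | hxy
    · simp [sepCount_self]
    · rw [SimpleGraph.dist_eq_one_iff_adj.mpr hxy, mul_one]
      exact sepCount_eq_of_ne hab fun h => hxy (Fin.castLE_injective hvk h)
  · intro i
    have hinj : Function.Injective fun x => e.symm i (Fin.castLE hvk x) :=
      (e.symm i).injective.comp (Fin.castLE_injective hvk)
    have h1 := card_filter_comp_le hinj fun z => z.val < k
    have h2 := card_filter_comp_le hinj fun z => ¬ z.val < k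
    rw [card_filter_val_lt_half] at h1
    rw [card_filter_not_val_lt_half] at h2
    have h3 := Finset.card_filter_add_card_filter_not (s := (Finset.univ : Finset (Fin v)))
      (fun x => (e.symm i (Fin.castLE hvk x)).val < k)
    simp only [Finset.card_univ, Fintype.card_fin] at h3
    simp only [decide_eq_true_eq, Fintype.card_fin]
    omega
end

section
/- Let Γ be a finite connected simple graph on v ≥ 2 vertices and suppose g is a scale-t embedding of Γ into the n-cube (t ≥ 1) such that no coordinate is constant (for every i ∈ Fin n there are vertices x, y with g(x)_i ≠ g(y)_i). Then n ≤ t·(v−1). -/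
/-- A function on the vertices of a connected graph taking two different values
takes different values at the ends of some edge. -/
theorem SimpleGraph.Connected.exists_adj_ne {V α : Type*} {G : SimpleGraph V}
    (hG : G.Connected) (f : V → α) {x y : V} (hxy : f x ≠ f y) :
    ∃ a b, G.Adj a b ∧ f a ≠ f b := by
  by_contra! h
  obtain ⟨p⟩ := hG.preconnected x y
  apply hxy
  clear hxy
  induction p with
  | nil => rfl
  | cons hadj _ ih => exact (h _ _ hadj).trans ih

/-- If a connected graph on `v ≥ 2` vertices has a scale-`t` embedding (`t ≥ 1`) into the
`n`-cube with no constant coordinate, then `n ≤ t·(v−1)`. -/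
theorem n_le_of_scale_embedding {V : Type*} [Fintype V] (G : SimpleGraph V)
    (hconn : G.Connected) (v t n : ℕ) (hv : Fintype.card V = v) (hv2 : 2 ≤ v)
    (ht : 1 ≤ t) (g : V → (Fin n → Bool)) (hg : IsScaleEmbedding G t n g)
    (hnc : ∀ i : Fin n, ∃ x y : V, g x i ≠ g y i) :
    n ≤ t * (v - 1) := by
  classical
  obtain ⟨T, hTG, hT⟩ := hconn.exists_isTree_le
  let S : Sym2 V → Finset (Fin n) := fun e => {i | ∃ x y, e = s(x, y) ∧ g x i ≠ g y i}
  have hcover : Finset.univ ⊆ T.edgeFinset.biUnion S := by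
    intro i _
    obtain ⟨x, y, hxy⟩ := hnc i
    obtain ⟨a, b, hab, hne⟩ := hT.connected.exists_adj_ne (fun z => g z i) hxy
    simp only [Finset.mem_biUnion, SimpleGraph.mem_edgeFinset, S, Finset.mem_filter,
      Finset.mem_univ, true_and]
    exact ⟨s(a, b), hab, a, b, rfl, hne⟩
  have hcard : ∀ e ∈ T.edgeFinset, (S e).card ≤ t := by
    intro e he
    induction e with
    | h a b =>
      have hab : T.Adj a b := by simpa using he
      have hdist := hg a b
      rw [SimpleGraph.dist_eq_one_iff_adj.mpr (hTG hab), mul_one] at hdist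
      rw [← hdist, hammingDist]
      refine Finset.card_le_card fun i hi => ?_
      obtain ⟨x, y, hxy, hne⟩ := by simpa [S, -Sym2.eq] using hi
      simp only [Finset.mem_filter, Finset.mem_univ, true_and]
      rcases Sym2.eq_iff.mp hxy with ⟨rfl, rfl⟩ | ⟨rfl, rfl⟩
      · exact hne
      · exact Ne.symm hne
  have hedges := hT.card_edgeFinset
  calc n = (Finset.univ : Finset (Fin n)).card := by simp
    _ ≤ (T.edgeFinset.biUnion S).card := Finset.card_le_card hcover
    _ ≤ T.edgeFinset.card * t := Finset.card_biUnion_le_card_mul _ _ _ hcard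
    _ = t * (v - 1) := by rw [mul_comm, ← hv, ← hedges, Nat.add_sub_cancel]
end

section
/- Let Γ be a finite connected simple graph on v ≥ 2 vertices admitting a scale-t embedding g into the n-cube (t ≥ 1) with no constant coordinate and with n = t·(v−1). Then Γ is a tree (Γ is connected and has no cycles). -/
/-- A function that takes two values at the ends of a walk changes along some edge of the walk. -/
theorem SimpleGraph.Walk.exists_mem_edges_map_not_isDiag {V α : Type*} {G : SimpleGraph V}
    {x y : V} (p : G.Walk x y) (f : V → α) (hf : f x ≠ f y) :
    ∃ e ∈ p.edges, ¬ (e.map f).IsDiag := by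
  by_contra! h
  refine hf ?_
  clear hf
  induction p with
  | nil => rfl
  | cons hadj p ih =>
    simp only [edges_cons, List.mem_cons, forall_eq_or_imp] at h
    have hstep := h.1
    simp only [Sym2.map_mk, Sym2.mk_isDiag_iff] at hstep
    exact hstep.trans (ih h.2)

/-- A nonconstant function on a connected graph changes along some edge. -/
theorem SimpleGraph.Connected.exists_edge_map_not_isDiag {V α : Type*} {G : SimpleGraph V}
    (hG : G.Connected) (f : V → α) (hf : ∃ x y, f x ≠ f y) :
    ∃ e ∈ G.edgeSet, ¬ (e.map f).IsDiag := by
  obtain ⟨x, y, hxy⟩ := hf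
  obtain ⟨p⟩ := hG.preconnected x y
  obtain ⟨e, he, hne⟩ := p.exists_mem_edges_map_not_isDiag f hxy
  exact ⟨e, p.edges_subset_edgeSet he, hne⟩

/-- If every edge of `T` is sent to a pair of Boolean vectors at Hamming distance `t`, and every
coordinate changes along at most one edge of `T`, then the ends of every trail `p` of `T` are sent
to vectors at Hamming distance `t * p.length`. -/
theorem SimpleGraph.Walk.IsTrail.hammingDist_eq_mul_length {V : Type*} {T : SimpleGraph V}
    {t n : ℕ} {g : V → (Fin n → Bool)} (hadj : ∀ x y, T.Adj x y → hammingDist (g x) (g y) = t)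
    (huniq : ∀ i : Fin n, ∀ e ∈ T.edgeSet, ∀ e' ∈ T.edgeSet,
      ¬ (e.map (g · i)).IsDiag → ¬ (e'.map (g · i)).IsDiag → e = e')
    {x y : V} {p : T.Walk x y} (hp : p.IsTrail) :
    hammingDist (g x) (g y) = t * p.length := by
  induction p with
  | nil => simp
  | @cons u v w h p ih =>
    rw [isTrail_cons] at hp
    have hdisj : ∀ i, g u i ≠ g v i → g v i ≠ g w i → False := by
      intro i huv hvw
      obtain ⟨e, he, hne⟩ := p.exists_mem_edges_map_not_isDiag (g · i) hvw
      have := huniq i s(u, v) h e (p.edges_subset_edgeSet he) (by simpa using huv) hne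
      exact hp.2 (this ▸ he)
    rw [length_cons, mul_add, mul_one, ← ih hp.1, ← hadj u v h, add_comm]
    unfold hammingDist
    rw [← Finset.card_union_of_disjoint]
    · congr 1
      ext i
      have := hdisj i
      simp only [Finset.mem_filter, Finset.mem_univ, true_and, Finset.mem_union]
      revert this
      cases g u i <;> cases g v i <;> cases g w i <;> simp
    · rw [Finset.disjoint_left]
      intro i h₁ h₂
      exact hdisj i (by simpa using h₁) (by simpa using h₂)

/-- If a tree `T` on `v` vertices is mapped to the cube of dimension `t * (v - 1)` with every edge
sent to a pair at Hamming distance `t` and no coordinate constant, then every coordinate changes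
along at most one edge. -/
theorem SimpleGraph.IsTree.eq_of_map_not_isDiag {V : Type*} [Fintype V] {T : SimpleGraph V}
    (hT : T.IsTree) {t n : ℕ} {g : V → (Fin n → Bool)}
    (hadj : ∀ x y, T.Adj x y → hammingDist (g x) (g y) = t)
    (hnc : ∀ i : Fin n, ∃ x y : V, g x i ≠ g y i) (hn : n = t * (Fintype.card V - 1))
    (i : Fin n) {e e' : Sym2 V} (he : e ∈ T.edgeSet) (he' : e' ∈ T.edgeSet)
    (hi : ¬ (e.map (g · i)).IsDiag) (hi' : ¬ (e'.map (g · i)).IsDiag) : e = e' := by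
  classical
  let c : Fin n → ℕ := fun i => (T.edgeFinset.filter fun e => ¬ (e.map (g · i)).IsDiag).card
  have hpos : ∀ i ∈ Finset.univ, 1 ≤ c i := fun i _ => by
    obtain ⟨e, he, hne⟩ := hT.connected.exists_edge_map_not_isDiag (g · i) (hnc i)
    exact Finset.card_pos.2 ⟨e, by simp [he, hne]⟩
  have hsum : ∑ i, c i = n := by
    have hedge : ∀ e ∈ T.edgeFinset,
        (Finset.univ.filter fun i => ¬ (e.map (g · i)).IsDiag).card = t := by
      intro e
      induction e with
      | _ x y =>
        intro he
        rw [← hadj x y (by simpa using he)]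
        simp [hammingDist]
    have hcard := hT.card_edgeFinset
    calc ∑ i, c i = ∑ e ∈ T.edgeFinset,
          (Finset.univ.filter fun i => ¬ (e.map (g · i)).IsDiag).card :=
        (Finset.sum_card_bipartiteAbove_eq_sum_card_bipartiteBelow
          (fun (i : Fin n) (e : Sym2 V) => ¬ (e.map (g · i)).IsDiag))
      _ = n := by
        rw [Finset.sum_congr rfl hedge, Finset.sum_const, smul_eq_mul, hn, ← hcard,
          Nat.add_sub_cancel, mul_comm]
  have hone : 1 = c i :=
    (Finset.sum_eq_sum_iff_of_le hpos).1 (by simp [hsum]) i (Finset.mem_univ i)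
  exact Finset.card_le_one.1 hone.ge e (by simp [he, hi]) e' (by simp [he', hi'])

/-- If a connected graph on `v ≥ 2` vertices has a scale-`t` embedding (`t ≥ 1`) into the
`n`-cube with no constant coordinate and `n = t·(v−1)`, then the graph is a tree. -/
theorem isTree_of_scale_embedding_eq {V : Type*} [Fintype V] (G : SimpleGraph V)
    (hconn : G.Connected) (v t n : ℕ) (hv : Fintype.card V = v) (hv2 : 2 ≤ v)
    (ht : 1 ≤ t) (g : V → (Fin n → Bool)) (hg : IsScaleEmbedding G t n g)
    (hnc : ∀ i : Fin n, ∃ x y : V, g x i ≠ g y i)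
    (heq : n = t * (v - 1)) :
    G.IsTree := by
  obtain ⟨T, hTG, hT⟩ := hconn.exists_isTree_le
  subst hv
  have hadj : ∀ x y, G.Adj x y → hammingDist (g x) (g y) = t := fun x y h => by
    rw [hg, SimpleGraph.dist_eq_one_iff_adj.2 h, mul_one]
  have hadjT : ∀ x y, T.Adj x y → hammingDist (g x) (g y) = t := fun x y h => hadj x y (hTG h)
  have hGT : G ≤ T := by
    intro x y hxy
    obtain ⟨p, hp⟩ := hT.connected.exists_isPath x y
    have hlen := hp.isTrail.hammingDist_eq_mul_length hadjT
      fun i _ he _ he' => hT.eq_of_map_not_isDiag hadjT hnc heq i he he'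
    rw [hadj x y hxy] at hlen
    exact p.adj_of_length_eq_one ((Nat.eq_of_mul_eq_mul_left ht (by rw [mul_one, ← hlen])).symm)
  rwa [le_antisymm hGT hTG]
end

section
/- Let T be a finite tree on v ≥ 2 vertices. Then W(T) ≤ v(v−1)(v+1)/6, where W(T) is the Wiener number, and equality holds if and only if T is isomorphic to the path P_v on v vertices. -/
namespace Finset

/-- Summing a symmetric function vanishing on the diagonal over ordered pairs counts every
unordered pair twice. -/
theorem two_mul_sum_sym2_lift {ι : Type*} (s : Finset ι) (f : ι → ι → ℕ)
    (hf : ∀ x y, f x y = f y x) (hdiag : ∀ x, f x x = 0) :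
    2 * ∑ p ∈ s.sym2, Sym2.lift ⟨f, hf⟩ p = ∑ x ∈ s, ∑ y ∈ s, f x y := by
  induction s using Finset.cons_induction with
  | empty => simp
  | cons a s ha ih =>
    rw [sym2_cons, sum_disjUnion, mul_add, ih]
    have hsymm : ∑ x ∈ s, f x a = ∑ x ∈ s, f a x := sum_congr rfl fun x _ => hf x a
    simp only [sum_map, Sym2.mkEmbedding_apply, Sym2.lift_mk, sum_cons, hdiag, sum_add_distrib,
      hsymm]
    ring

/-- If the values of `f` on `s` form an initial segment of `ℕ`, then their sum is at most
`0 + 1 + ⋯ + (#s - 1)`, with equality only if `f` is injective on `s`. -/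
theorem two_mul_sum_add_card_le_sq {ι : Type*} (s : Finset ι) (f : ι → ℕ)
    (hf : ∀ y ∈ s, ∀ k < f y, ∃ z ∈ s, f z = k) :
    2 * ∑ y ∈ s, f y + s.card ≤ s.card ^ 2 ∧
      (2 * ∑ y ∈ s, f y + s.card = s.card ^ 2 → Set.InjOn f s) := by
  classical
  induction hn : s.card generalizing s with
  | zero => simp [Finset.card_eq_zero.mp hn]
  | succ n ih =>
    have hs : s.Nonempty := Finset.card_pos.mp (by lia)
    obtain ⟨m, hm, hmax⟩ := s.exists_max_image f hs
    have hrange : range (f m + 1) ⊆ s.image f := by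
      intro k hk
      rw [mem_range, Nat.lt_succ_iff] at hk
      rcases hk.eq_or_lt with rfl | hk
      · exact mem_image_of_mem f hm
      · simpa using hf m hm k hk
    have hcard := Finset.card_le_card hrange
    have himage := card_image_le (s := s) (f := f)
    rw [card_range] at hcard
    have herase : (s.erase m).card = n := by rw [card_erase_of_mem hm, hn]; rfl
    have hbound := (ih (s.erase m) (by
      intro y hy k hk
      obtain ⟨z, hz, rfl⟩ := hf y (mem_of_mem_erase hy) k hk
      refine ⟨z, mem_erase.mpr ⟨?_, hz⟩, rfl⟩
      rintro rfl
      exact absurd (hmax y (mem_of_mem_erase hy)) (by lia)) herase).1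
    rw [← add_sum_erase s f hm]
    refine ⟨by nlinarith, fun heq => card_image_iff.mp ?_⟩
    have : n ≤ f m := by nlinarith
    lia

end Finset

namespace SimpleGraph

variable {V W : Type*} {G : SimpleGraph V}

theorem Connected.exists_adj_dist_eq (hG : G.Connected) {x y : V} {k : ℕ}
    (h : G.dist x y = k + 1) : ∃ z, G.Adj y z ∧ G.dist x z = k := by
  obtain ⟨p, hp⟩ := hG.exists_walk_length_eq_dist y x
  rw [dist_comm, h] at hp
  cases p with
  | nil => simp at hp
  | @cons _ z _ hadj q =>
    have hle := dist_le q
    have htri := hG.dist_triangle (u := x) (v := z) (w := y)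
    rw [dist_eq_one_iff_adj.mpr hadj.symm] at htri
    rw [Walk.length_cons] at hp
    rw [dist_comm] at hle
    exact ⟨z, hadj, by lia⟩

theorem Connected.exists_dist_eq_of_lt (hG : G.Connected) {x y : V} {k : ℕ}
    (h : k < G.dist x y) : ∃ z, G.dist x z = k := by
  induction hd : G.dist x y generalizing y with
  | zero => lia
  | succ d ih =>
    obtain ⟨z, -, hz⟩ := hG.exists_adj_dist_eq hd
    rcases (show k ≤ d by lia).eq_or_lt with rfl | hk
    · exact ⟨z, hz⟩
    · exact ih (by lia) hz

theorem Connected.two_mul_sum_dist_add_card_le [Fintype V] (hG : G.Connected) (x : V) :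
    2 * ∑ y, G.dist x y + Fintype.card V ≤ Fintype.card V ^ 2 ∧
      (2 * ∑ y, G.dist x y + Fintype.card V = Fintype.card V ^ 2 →
        Function.Injective (G.dist x)) := by
  have h := Finset.univ.two_mul_sum_add_card_le_sq (G.dist x)
    fun y _ k hk => by simpa using hG.exists_dist_eq_of_lt hk
  rwa [Finset.coe_univ, Set.injOn_univ] at h

/-- A connected graph whose vertices all have different distances from `x` is a path. -/
theorem Connected.nonempty_iso_pathGraph [Fintype V] (hG : G.Connected) {x : V}
    (hinj : Function.Injective (G.dist x)) :
    Nonempty (G ≃g pathGraph (Fintype.card V)) := by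
  classical
  have hlt (y : V) : G.dist x y < Fintype.card V := by
    have hsub : Finset.range (G.dist x y + 1) ⊆ Finset.univ.image (G.dist x) := by
      intro k hk
      rw [Finset.mem_range, Nat.lt_succ_iff] at hk
      rcases hk.eq_or_lt with rfl | hk
      · simp
      · simpa using hG.exists_dist_eq_of_lt hk
    have := (Finset.card_le_card hsub).trans Finset.card_image_le
    rwa [Finset.card_range, Finset.card_univ] at this
  let f : V → Fin (Fintype.card V) := fun y => ⟨G.dist x y, hlt y⟩
  have hf : Function.Bijective f :=
    (Fintype.bijective_iff_injective_and_card f).mpr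
      ⟨fun y z h => hinj (congrArg Fin.val h), by simp⟩
  refine ⟨⟨Equiv.ofBijective f hf, ?_⟩⟩
  intro y z
  have hadj {y z : V} (h : G.dist x y + 1 = G.dist x z) : G.Adj y z := by
    obtain ⟨w, hw, hd⟩ := hG.exists_adj_dist_eq h.symm
    exact hinj hd ▸ hw.symm
  simp only [pathGraph_adj, Equiv.ofBijective_apply, f]
  refine ⟨fun h => h.elim hadj fun h => (hadj h).symm, fun h => ?_⟩
  have hne : G.dist x y ≠ G.dist x z := fun h' => h.ne (hinj h')
  have := h.diff_dist_adj (u := x)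
  lia

theorem Reachable.dist_map_le {H : SimpleGraph W} (f : G →g H) {x y : V} (h : G.Reachable x y) :
    H.dist (f x) (f y) ≤ G.dist x y := by
  obtain ⟨p, hp⟩ := h.exists_walk_length_eq_dist
  rw [← hp, ← p.length_map f]
  exact dist_le _

theorem natDist_le_dist_of_hom_pathGraph {n : ℕ} (f : G →g pathGraph n) {x y : V}
    (h : G.Reachable x y) : Nat.dist (f x) (f y) ≤ G.dist x y := by
  obtain ⟨p, hp⟩ := h.exists_walk_length_eq_dist
  rw [← hp]
  clear hp h
  induction p with
  | nil => simp
  | cons hadj q ih =>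
    have := pathGraph_adj.mp (f.map_adj hadj)
    rw [Walk.length_cons]
    unfold Nat.dist at *
    lia

theorem two_mul_wiener [Fintype V] (G : SimpleGraph V) :
    2 * wiener G = ∑ x, ∑ y, G.dist x y :=
  Finset.univ.two_mul_sum_sym2_lift _ _ fun _ => dist_self

/-- Deleting a non-cut vertex `a` lowers the Wiener number by at most the sum of the distances
from `a`. -/
theorem wiener_le_wiener_induce_add [Fintype V] [DecidableEq V] {a : V}
    (ha : (G.induce {a}ᶜ).Connected) :
    wiener G ≤ wiener (G.induce {a}ᶜ) + ∑ y, G.dist a y := by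
  have hsplit (f : V → ℕ) : ∑ x, f x = f a + ∑ x : ({a}ᶜ : Set V), f x := by
    rw [Fintype.sum_eq_add_sum_compl a]
    congr 1
    exact Finset.sum_subtype _ (by simp) f
  have hsub : ∑ x : ({a}ᶜ : Set V), ∑ y : ({a}ᶜ : Set V), G.dist x y ≤
      2 * wiener (G.induce {a}ᶜ) := by
    rw [two_mul_wiener]
    exact Finset.sum_le_sum fun x _ => Finset.sum_le_sum fun y _ =>
      (ha x y).dist_map_le (Embedding.induce _).toHom
  have htotal : 2 * wiener G = ∑ y, G.dist a y + (∑ x : ({a}ᶜ : Set V), G.dist x a +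
      ∑ x : ({a}ᶜ : Set V), ∑ y : ({a}ᶜ : Set V), G.dist x y) := by
    rw [two_mul_wiener, hsplit, ← Finset.sum_add_distrib]
    congr 1
    exact Finset.sum_congr rfl fun x _ => hsplit _
  have hcol : ∑ x : ({a}ᶜ : Set V), G.dist x a = ∑ y, G.dist a y := by
    rw [hsplit (G.dist a), dist_self, zero_add]
    exact Finset.sum_congr rfl fun x _ => dist_comm
  lia

/-- Among connected graphs of a given order, the Wiener number is at most that of a path, with
equality only for a path. -/
theorem Connected.six_mul_wiener_add_card_le [Fintype V] (hG : G.Connected) :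
    6 * wiener G + Fintype.card V ≤ Fintype.card V ^ 3 ∧
      (6 * wiener G + Fintype.card V = Fintype.card V ^ 3 →
        Nonempty (G ≃g pathGraph (Fintype.card V))) := by
  classical
  induction hn : Fintype.card V generalizing V with
  | zero => exact absurd hn (@Fintype.card_ne_zero V _ hG.nonempty)
  | succ n ih =>
    rw [← hn]
    rcases subsingleton_or_nontrivial V with hV | hV
    · obtain ⟨x⟩ := hG.nonempty
      have hcard : Fintype.card V = 1 := Fintype.card_eq_one_iff.mpr ⟨x, fun y => hV.elim y x⟩
      have hzero : 2 * wiener G = 0 := by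
        rw [two_mul_wiener]
        simp [Subsingleton.elim _ x]
      exact ⟨by rw [hcard]; lia, fun _ =>
        hG.nonempty_iso_pathGraph (x := x) (Function.injective_of_subsingleton _)⟩
    · obtain ⟨a, ha⟩ := hG.exists_connected_induce_compl_singleton_of_finite_nontrivial
      have hcard : Fintype.card ({a}ᶜ : Set V) = n := by
        rw [Fintype.card_compl_set, hn]; simp
      have hrec := (ih ha hcard).1
      have hle := wiener_le_wiener_induce_add ha
      obtain ⟨hdist, hinj⟩ := hG.two_mul_sum_dist_add_card_le a
      refine ⟨?_, fun heq => hG.nonempty_iso_pathGraph (hinj (hdist.antisymm ?_))⟩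
      · rw [hn] at hdist ⊢
        nlinarith
      · rw [hn] at heq ⊢
        nlinarith

end SimpleGraph

theorem Finset.three_mul_sum_range_natDist (n : ℕ) :
    3 * ∑ i ∈ range n, ∑ j ∈ range n, Nat.dist i j + n = n ^ 3 := by
  have hlast (m : ℕ) : 2 * ∑ i ∈ range m, Nat.dist i m = m * (m + 1) := by
    have h : ∑ i ∈ range m, Nat.dist i m = ∑ i ∈ range m, (i + 1) := by
      rw [← sum_range_reflect]
      refine sum_congr rfl fun i hi => ?_
      rw [mem_range] at hi
      unfold Nat.dist
      lia
    rw [h]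
    clear h
    induction m with
    | zero => rfl
    | succ m ih => rw [sum_range_succ, mul_add, ih]; ring
  induction n with
  | zero => rfl
  | succ n ih =>
    have h : ∑ j ∈ range n, Nat.dist n j = ∑ i ∈ range n, Nat.dist i n :=
      sum_congr rfl fun j _ => Nat.dist_comm n j
    simp only [sum_range_succ, sum_add_distrib, Nat.dist_self, h]
    have := hlast n
    nlinarith

theorem SimpleGraph.Iso.card_pow_three_le_six_mul_wiener_add {V : Type*} [Fintype V]
    {G : SimpleGraph V} {n : ℕ} (e : G ≃g pathGraph n) (hG : G.Connected) :
    n ^ 3 ≤ 6 * wiener G + n := by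
  have h : ∑ i ∈ Finset.range n, ∑ j ∈ Finset.range n, Nat.dist i j ≤ 2 * wiener G := by
    rw [two_mul_wiener, Finset.sum_range, ← e.toEquiv.sum_comp]
    refine Finset.sum_le_sum fun x _ => ?_
    rw [Finset.sum_range, ← e.toEquiv.sum_comp]
    exact Finset.sum_le_sum fun y _ => natDist_le_dist_of_hom_pathGraph e.toHom (hG x y)
  have := Finset.three_mul_sum_range_natDist n
  lia

/-- For a tree `T` on `v ≥ 2` vertices, `W(T) ≤ v(v−1)(v+1)/6`, with equality if and
only if `T` is isomorphic to the path `P_v` on `v` vertices. -/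
theorem wiener_tree_upper_bound {V : Type*} [Fintype V] (G : SimpleGraph V)
    (htree : G.IsTree) (v : ℕ) (hv : Fintype.card V = v) (hv2 : 2 ≤ v) :
    6 * wiener G ≤ v * (v - 1) * (v + 1) ∧
      (6 * wiener G = v * (v - 1) * (v + 1) ↔
        Nonempty (G ≃g SimpleGraph.pathGraph v)) := by
  subst hv
  obtain ⟨hle, hiso⟩ := htree.connected.six_mul_wiener_add_card_le
  have hcube : Fintype.card V * (Fintype.card V - 1) * (Fintype.card V + 1) + Fintype.card V =
      Fintype.card V ^ 3 := by
    obtain ⟨m, hm⟩ := Nat.exists_eq_add_of_le' (show 1 ≤ Fintype.card V by lia)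
    rw [hm, Nat.add_sub_cancel]
    ring
  refine ⟨by lia, fun h => hiso (by lia), fun ⟨e⟩ => ?_⟩
  have := e.card_pow_three_le_six_mul_wiener_add htree.connected
  lia
end

section
/- Let Γ be a finite connected simple graph on v ≥ 4 vertices admitting an equicut scale-t embedding into the n-cube. Then Γ is 2-connected: for every vertex x, the subgraph of Γ induced on the set of all vertices other than x is connected. -/
/-- If `y` and `z` cannot be joined after deleting `x`, then every geodesic between them
passes through `x`. -/
theorem dist_add_dist_le_of_not_reachable_induce {V : Type*} {G : SimpleGraph V}
    (hconn : G.Connected) {x y z : V} (hy : y ∈ ({x}ᶜ : Set V)) (hz : z ∈ ({x}ᶜ : Set V))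
    (h : ¬ (G.induce ({x}ᶜ : Set V)).Reachable ⟨y, hy⟩ ⟨z, hz⟩) :
    G.dist y x + G.dist x z ≤ G.dist y z := by
  classical
  obtain ⟨p, hp⟩ := hconn.exists_walk_length_eq_dist y z
  by_cases hx : x ∈ p.support
  · have hlen := congrArg SimpleGraph.Walk.length (p.take_spec hx)
    rw [SimpleGraph.Walk.length_append] at hlen
    have h1 := SimpleGraph.dist_le (p.takeUntil x hx)
    have h2 := SimpleGraph.dist_le (p.dropUntil x hx)
    lia
  · refine absurd ⟨p.induce _ fun w hw => ?_⟩ h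
    rintro rfl
    exact hx hw

/-- Boolean vectors lying on a Hamming geodesic through `b` cannot both differ from `b`
in the same coordinate. -/
theorem eq_or_eq_of_hammingDist_add_le {ι : Type*} [Fintype ι] {a b c : ι → Bool}
    (h : hammingDist a b + hammingDist b c ≤ hammingDist a c) (i : ι) :
    a i = b i ∨ c i = b i := by
  classical
  by_contra! hne
  have hsub : Finset.univ.filter (fun j => a j ≠ c j) ⊆
      (Finset.univ.filter (fun j => a j ≠ b j) ∪
        Finset.univ.filter (fun j => b j ≠ c j)).erase i := by
    intro j hj
    simp only [Finset.mem_erase, Finset.mem_union, Finset.mem_filter, Finset.mem_univ,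
      true_and] at hj ⊢
    refine ⟨?_, ?_⟩
    · rintro rfl
      exact hj ((Bool.eq_not_of_ne hne.1).trans (Bool.eq_not_of_ne hne.2).symm)
    · by_contra! hj'
      exact hj (hj'.1.trans hj'.2)
  have hi : i ∈ Finset.univ.filter (fun j => a j ≠ b j) ∪
      Finset.univ.filter (fun j => b j ≠ c j) := by simp [hne.1]
  have h1 := Finset.card_le_card hsub
  have h2 := Finset.card_erase_lt_of_mem hi
  have h3 := Finset.card_union_le (Finset.univ.filter (fun j => a j ≠ b j))
    (Finset.univ.filter (fun j => b j ≠ c j))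
  simp only [hammingDist] at h
  lia

/-- Each side of a cut of an equicut embedding has at least `⌊v/2⌋` vertices. -/
theorem IsEquicut.half_card_le {V : Type*} [Fintype V] [DecidableEq V] {n : ℕ}
    {g : V → (Fin n → Bool)} (heq : IsEquicut n g) (i : Fin n) (b : Bool) :
    Fintype.card V / 2 ≤ (Finset.univ.filter (fun y => g y i ≠ b)).card := by
  have hsum := Finset.card_filter_add_card_filter_not (s := (Finset.univ : Finset V))
    (fun y => g y i = true)
  rw [Finset.card_univ] at hsum
  have hi := heq i
  cases b
  · simp only [ne_eq, Bool.not_eq_false]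
    lia
  · simp only [ne_eq]
    lia

/-- A scale embedding of positive scale is injective. -/
theorem IsScaleEmbedding.injective {V : Type*} [Fintype V] {G : SimpleGraph V} {t n : ℕ}
    {g : V → (Fin n → Bool)} (hg : IsScaleEmbedding G t n g) (hconn : G.Connected)
    (ht : 1 ≤ t) : Function.Injective g := by
  intro y z hyz
  have h := hg y z
  rw [hyz, hammingDist_self] at h
  rcases Nat.mul_eq_zero.mp h.symm with h | h
  · lia
  · exact hconn.dist_eq_zero_iff.mp h

/-- A connected graph on `v ≥ 4` vertices admitting an equicut scale-`t` embedding into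
the `n`-cube is 2-connected: deleting any single vertex leaves a connected graph. -/
theorem equicut_two_connected {V : Type*} [Fintype V] [DecidableEq V]
    (G : SimpleGraph V) (hconn : G.Connected) (hcard : 4 ≤ Fintype.card V)
    (t n : ℕ) (ht : 1 ≤ t) (g : V → (Fin n → Bool))
    (hg : IsScaleEmbedding G t n g) (heq : IsEquicut n g) :
    ∀ x : V, (G.induce ({x}ᶜ : Set V)).Connected := by
  classical
  intro x
  have : Nontrivial V := Fintype.one_lt_card_iff_nontrivial.mp (by lia)
  obtain ⟨w, hw⟩ := exists_ne x
  have : Nonempty ({x}ᶜ : Set V) := ⟨⟨w, hw⟩⟩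
  refine ⟨?_⟩
  by_contra hpre
  simp only [SimpleGraph.Preconnected, not_forall] at hpre
  obtain ⟨⟨a, ha⟩, ⟨b, hb⟩, hab⟩ := hpre
  have hinj := hg.injective hconn ht
  let A : Finset V := Finset.univ.filter fun y =>
    ∃ hy : y ∈ ({x}ᶜ : Set V), (G.induce ({x}ᶜ : Set V)).Reachable ⟨a, ha⟩ ⟨y, hy⟩
  let B : Finset V := (Finset.univ.erase x) \ A
  let S : Fin n → Finset V := fun i => Finset.univ.filter fun y => g y i ≠ g x i
  have haA : a ∈ A :=
    Finset.mem_filter.mpr ⟨Finset.mem_univ a, ha, SimpleGraph.Reachable.refl _⟩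
  have hbB : b ∈ B := by
    simp only [B, A, Finset.mem_sdiff, Finset.mem_erase, Finset.mem_univ, Finset.mem_filter]
    exact ⟨⟨hb, trivial⟩, fun h => hab h.2.2⟩
  have hxS (i : Fin n) : x ∉ S i := by simp [S]
  have hsep (i : Fin n) {y z : V} (hy : y ∈ A) (hz : z ∈ B) (hyS : y ∈ S i) : z ∉ S i := by
    simp only [A, Finset.mem_filter, Finset.mem_univ, true_and] at hy
    simp only [B, A, Finset.mem_sdiff, Finset.mem_erase, Finset.mem_univ, Finset.mem_filter,
      true_and, and_true] at hz
    obtain ⟨hyx, hay⟩ := hy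
    have hd := dist_add_dist_le_of_not_reachable_induce hconn hyx hz.1
      fun hyz => hz.2 ⟨hz.1, hay.trans hyz⟩
    have hh : hammingDist (g y) (g x) + hammingDist (g x) (g z) ≤ hammingDist (g y) (g z) := by
      rw [hg, hg, hg, ← mul_add]
      exact Nat.mul_le_mul_left t hd
    have := eq_or_eq_of_hammingDist_add_le hh i
    simp only [S, Finset.mem_filter, Finset.mem_univ, true_and] at hyS ⊢
    tauto
  have hAx : A ⊆ Finset.univ.erase x := by
    intro y hy
    simp only [A, Finset.mem_filter, Finset.mem_univ, true_and] at hy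
    exact Finset.mem_erase.mpr ⟨hy.1, Finset.mem_univ y⟩
  have hSA {i : Fin n} {y : V} (hy : y ∈ A) (hyS : y ∈ S i) : S i ⊆ A := by
    intro z hzS
    by_contra hzA
    have hzx : z ≠ x := fun h => hxS i (h ▸ hzS)
    exact hsep i hy (Finset.mem_sdiff.mpr ⟨by simp [hzx], hzA⟩) hyS hzS
  have hSB {i : Fin n} {z : V} (hz : z ∈ B) (hzS : z ∈ S i) : S i ⊆ B := by
    intro y hyS
    have hyx : y ≠ x := fun h => hxS i (h ▸ hyS)
    exact Finset.mem_sdiff.mpr ⟨by simp [hyx], fun hyA => hsep i hyA hz hyS hzS⟩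
  have hS (i : Fin n) : Fintype.card V / 2 ≤ (S i).card := heq.half_card_le i (g x i)
  have hcut {y : V} (hyx : y ≠ x) : ∃ i, y ∈ S i := by
    obtain ⟨i, hi⟩ := Function.ne_iff.mp (hinj.ne hyx)
    exact ⟨i, by simpa [S] using hi⟩
  obtain ⟨i, hi⟩ := hcut ha
  obtain ⟨j, hj⟩ := hcut hb
  have hA := (hS i).trans (Finset.card_le_card (hSA haA hi))
  have hB := (hS j).trans (Finset.card_le_card (hSB hbB hj))
  have hAB : B.card + A.card = Fintype.card V - 1 := by
    rw [Finset.card_sdiff_add_card_eq_card hAx, Finset.card_erase_of_mem (Finset.mem_univ x),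
      Finset.card_univ]
  obtain ⟨y, hy, z, hz, hyz⟩ := Finset.one_lt_card.mp (show 1 < A.card by lia)
  obtain ⟨k, hk⟩ := Function.ne_iff.mp (hinj.ne hyz)
  have hfull {u : V} (hu : u ∈ A) (huS : u ∈ S k) : S k = A :=
    Finset.eq_of_subset_of_card_le (hSA hu huS) (by have := hS k; lia)
  have hSk : S k = A := by
    by_cases hyk : g y k = g x k
    · exact hfull hz (by simpa [S, ← hyk] using hk.symm)
    · exact hfull hy (by simpa [S] using hyk)
  rw [← hSk] at hy hz
  simp only [S, Finset.mem_filter, Finset.mem_univ, true_and] at hy hz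
  exact hk ((Bool.eq_not_of_ne hy).trans (Bool.eq_not_of_ne hz).symm)
end

section
/- Let Γ be a finite connected simple graph on v ≥ 4 vertices and let g be an equicut scale-t embedding of Γ into the n-cube with no constant coordinate. Then n·⌈v/2⌉ ≥ t·(2·⌈v/2⌉ − 1), and if n·⌈v/2⌉ = t·(2·⌈v/2⌉ − 1) then Γ is the complete graph K_v. -/
/-- The number of ordered pairs separated by a cut `b` is twice the product of the sizes of
its two sides. -/
theorem sum_sum_ite_ne_eq_two_mul {V : Type*} [Fintype V] (b : V → Bool) :
    ∑ x : V, ∑ y : V, (if b x ≠ b y then 1 else 0) =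
      2 * ((Finset.univ.filter (fun x : V => b x = true)).card *
        (Finset.univ.filter (fun x : V => b x = false)).card) := by
  have h : ∀ x : V, ∑ y : V, (if b x ≠ b y then 1 else 0) =
      (if b x = true then (Finset.univ.filter (fun x : V => b x = false)).card else 0) +
      (if b x = false then (Finset.univ.filter (fun x : V => b x = true)).card else 0) := by
    intro x
    rw [Finset.card_filter, Finset.card_filter]
    cases hb : b x <;> simp
  simp only [h, Finset.sum_add_distrib, ← Finset.sum_filter, Finset.sum_const, smul_eq_mul]
  ring

/-- The total Hamming distance over ordered pairs, computed one coordinate at a time. -/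
theorem sum_sum_hammingDist {V : Type*} [Fintype V] {n : ℕ} (g : V → (Fin n → Bool)) :
    ∑ x : V, ∑ y : V, hammingDist (g x) (g y) =
      ∑ i : Fin n, 2 * ((Finset.univ.filter (fun x : V => g x i = true)).card *
        (Finset.univ.filter (fun x : V => g x i = false)).card) := by
  simp only [hammingDist, Finset.card_filter (fun i => g _ i ≠ g _ i)]
  simp_rw [Finset.sum_comm (s := (Finset.univ : Finset V)) (t := (Finset.univ : Finset (Fin n)))]
  exact Finset.sum_congr rfl fun i _ => sum_sum_ite_ne_eq_two_mul fun x => g x i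

/-- The total Hamming distance over ordered pairs of an equicut map. -/
theorem IsEquicut.sum_sum_hammingDist {V : Type*} [Fintype V] [DecidableEq V] {n : ℕ}
    {g : V → (Fin n → Bool)} (h : IsEquicut n g) :
    ∑ x : V, ∑ y : V, hammingDist (g x) (g y) =
      n * (2 * ((Fintype.card V / 2) * ((Fintype.card V + 1) / 2))) := by
  have hi : ∀ i : Fin n, 2 * ((Finset.univ.filter (fun x : V => g x i = true)).card *
      (Finset.univ.filter (fun x : V => g x i = false)).card) =
      2 * ((Fintype.card V / 2) * ((Fintype.card V + 1) / 2)) := by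
    intro i
    have hc := Finset.card_filter_add_card_filter_not (s := (Finset.univ : Finset V))
      (fun x : V => g x i = true)
    simp only [Bool.not_eq_true, Finset.card_univ] at hc
    rcases h i with hk | hk
    · rw [hk] at hc ⊢
      congr 2
      omega
    · rw [hk] at hc ⊢
      rw [mul_comm ((Fintype.card V + 1) / 2)]
      congr 2
      omega
  simp [_root_.sum_sum_hammingDist, hi]

theorem sum_sum_ite_eq_zero_one {V : Type*} [Fintype V] [DecidableEq V] :
    ∑ x : V, ∑ y : V, (if x = y then 0 else 1) = Fintype.card V * (Fintype.card V - 1) := by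
  have h : ∀ x : V, ∑ y : V, (if x = y then 0 else 1) = Fintype.card V - 1 := by
    intro x
    rw [← Finset.card_univ, ← Finset.card_erase_of_mem (Finset.mem_univ x),
      Finset.card_eq_sum_ones, ← Finset.filter_ne, Finset.sum_filter]
    simp only [ne_eq, ite_not]
  simp [h]

theorem SimpleGraph.Connected.ite_eq_le_dist {V : Type*} [DecidableEq V] {G : SimpleGraph V}
    (hG : G.Connected) (x y : V) : (if x = y then 0 else 1) ≤ G.dist x y := by
  split_ifs with h
  · exact Nat.zero_le _
  · exact hG.pos_dist_of_ne h

theorem SimpleGraph.Connected.card_mul_le_sum_sum_dist {V : Type*} [Fintype V] [DecidableEq V]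
    {G : SimpleGraph V} (hG : G.Connected) :
    Fintype.card V * (Fintype.card V - 1) ≤ ∑ x : V, ∑ y : V, G.dist x y := by
  rw [← sum_sum_ite_eq_zero_one]
  exact Finset.sum_le_sum fun x _ => Finset.sum_le_sum fun y _ => hG.ite_eq_le_dist x y

/-- A connected graph with the least possible total distance is complete. -/
theorem SimpleGraph.Connected.eq_top_of_sum_sum_dist {V : Type*} [Fintype V] [DecidableEq V]
    {G : SimpleGraph V} (hG : G.Connected)
    (h : ∑ x : V, ∑ y : V, G.dist x y = Fintype.card V * (Fintype.card V - 1)) : G = ⊤ := by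
  rw [← sum_sum_ite_eq_zero_one, eq_comm, Finset.sum_eq_sum_iff_of_le
    fun x _ => Finset.sum_le_sum fun y _ => hG.ite_eq_le_dist x y] at h
  ext x y
  rw [SimpleGraph.top_adj]
  refine ⟨fun hxy => hxy.ne, fun hne => ?_⟩
  have hy := (Finset.sum_eq_sum_iff_of_le fun y _ => hG.ite_eq_le_dist x y).1
    (h x (Finset.mem_univ x)) y (Finset.mem_univ y)
  rw [if_neg hne] at hy
  exact SimpleGraph.dist_eq_one_iff_adj.1 hy.symm

/-- For a connected graph `Γ` on `v ≥ 4` vertices with an equicut scale-`t` embedding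
into the `n`-cube having no constant coordinate, `n·⌈v/2⌉ ≥ t·(2⌈v/2⌉ − 1)`, and if
equality holds then `Γ` is the complete graph `K_v`. -/
theorem equicut_lower_size {V : Type*} [Fintype V] [DecidableEq V]
    (G : SimpleGraph V) (hconn : G.Connected) (v t n : ℕ)
    (hv : Fintype.card V = v) (hv4 : 4 ≤ v)
    (ht : 1 ≤ t) (g : V → (Fin n → Bool))
    (hg : IsScaleEmbedding G t n g) (heq : IsEquicut n g)
    (hnc : ∀ i : Fin n, ∃ x y : V, g x i ≠ g y i) :
    t * (2 * ((v + 1) / 2) - 1) ≤ n * ((v + 1) / 2) ∧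
      (n * ((v + 1) / 2) = t * (2 * ((v + 1) / 2) - 1) → G = ⊤) := by
  subst hv
  set D := ∑ x : V, ∑ y : V, G.dist x y with hD
  have hS : t * D = n * (2 * ((Fintype.card V / 2) * ((Fintype.card V + 1) / 2))) := by
    rw [← heq.sum_sum_hammingDist, hD]
    simp only [hg _ _, Finset.mul_sum]
  have hle : Fintype.card V * (Fintype.card V - 1) ≤ D := hconn.card_mul_le_sum_sum_dist
  have htop : D = Fintype.card V * (Fintype.card V - 1) → G = ⊤ := hconn.eq_top_of_sum_sum_dist
  set v := Fintype.card V
  set c := (v + 1) / 2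
  have hprod : v * (v - 1) = 2 * (v / 2) * (2 * c - 1) := by
    rcases Nat.even_or_odd v with hev | hodd
    · rw [show 2 * (v / 2) = v by grind, show 2 * c - 1 = v - 1 by grind]
    · rw [show 2 * (v / 2) = v - 1 by grind, show 2 * c - 1 = v by grind, mul_comm]
  have hf : 0 < 2 * (v / 2) := by omega
  have hS' : t * D = 2 * (v / 2) * (n * c) := by rw [hS]; ring
  rw [hprod] at hle htop
  refine ⟨Nat.le_of_mul_le_mul_left ?_ hf, fun h => htop (Nat.eq_of_mul_eq_mul_left ht ?_)⟩
  · calc 2 * (v / 2) * (t * (2 * c - 1)) = t * (2 * (v / 2) * (2 * c - 1)) := by ring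
      _ ≤ t * D := Nat.mul_le_mul_left t hle
      _ = 2 * (v / 2) * (n * c) := hS'
  · rw [hS', h]
    ring
end

section
/- Let Γ be a finite connected simple graph with at least 2 vertices and diameter D, and let □Γ be its diametral doubling. Then the natural copy of Γ in □Γ is isometric (d_{□Γ}(x⁺, y⁺) = d_Γ(x,y) for all vertices x, y of Γ) if and only if condition (I) holds: for all vertices x, y, z₁, z₂ of Γ with d_Γ(x,z₁) = D and d_Γ(y,z₂) = D one has d_Γ(x,y) ≤ 2 + d_Γ(z₁,z₂). -/
/-- The diametral doubling `□Γ` of a graph `Γ` with diameter `D`: two copies of the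
vertex set; within each copy the adjacency of `Γ`, and across the copies `x⁺ ~ y⁻`
iff `d_Γ(x,y) = D`. -/
def doubling {V : Type*} (G : SimpleGraph V) (D : ℕ) : SimpleGraph (V ⊕ V) :=
  SimpleGraph.fromRel (fun u w => match u, w with
    | Sum.inl x, Sum.inl y => G.Adj x y
    | Sum.inr x, Sum.inr y => G.Adj x y
    | Sum.inl x, Sum.inr y => G.dist x y = D
    | Sum.inr _, Sum.inl _ => False)

/-- Condition (I): for all vertices `x, y, z₁, z₂` with `d(x,z₁) = D` and
`d(y,z₂) = D` one has `d(x,y) ≤ 2 + d(z₁,z₂)`. -/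
def CondI {W : Type*} (H : SimpleGraph W) (D : ℕ) : Prop :=
  ∀ x y z₁ z₂ : W, H.dist x z₁ = D → H.dist y z₂ = D →
    H.dist x y ≤ 2 + H.dist z₁ z₂

/-- Condition (II): every pair of vertices lies on a geodesic of length `D`. -/
def CondII {W : Type*} (H : SimpleGraph W) (D : ℕ) : Prop :=
  ∀ x y : W, ∃ z₁ z₂ : W, H.dist z₁ z₂ = D ∧
    H.dist z₁ x + H.dist x y + H.dist y z₂ = D

theorem doubling_adj_inl_inl {V : Type*} {G : SimpleGraph V} {D : ℕ} {x y : V} :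
    (doubling G D).Adj (Sum.inl x) (Sum.inl y) ↔ G.Adj x y := by
  simp only [doubling, SimpleGraph.fromRel_adj, ne_eq, Sum.inl.injEq, G.adj_comm y x, or_self,
    and_iff_right_iff_imp]
  exact fun h => h.ne

theorem doubling_adj_inr_inr {V : Type*} {G : SimpleGraph V} {D : ℕ} {x y : V} :
    (doubling G D).Adj (Sum.inr x) (Sum.inr y) ↔ G.Adj x y := by
  simp only [doubling, SimpleGraph.fromRel_adj, ne_eq, Sum.inr.injEq, G.adj_comm y x, or_self,
    and_iff_right_iff_imp]
  exact fun h => h.ne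

theorem doubling_adj_inl_inr {V : Type*} {G : SimpleGraph V} {D : ℕ} {x y : V} :
    (doubling G D).Adj (Sum.inl x) (Sum.inr y) ↔ G.dist x y = D := by
  simp [doubling]

theorem doubling_adj_inr_inl {V : Type*} {G : SimpleGraph V} {D : ℕ} {x y : V} :
    (doubling G D).Adj (Sum.inr x) (Sum.inl y) ↔ G.dist y x = D := by
  simp [doubling]

/-- The embedding of `Γ` in its diametral doubling as the copy `V⁺`. -/
def doublingInl {V : Type*} (G : SimpleGraph V) (D : ℕ) : G →g doubling G D where
  toFun := Sum.inl
  map_rel' := doubling_adj_inl_inl.2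

/-- The embedding of `Γ` in its diametral doubling as the copy `V⁻`. -/
def doublingInr {V : Type*} (G : SimpleGraph V) (D : ℕ) : G →g doubling G D where
  toFun := Sum.inr
  map_rel' := doubling_adj_inr_inr.2

/-- Under condition (I), a walk in the doubling ending at `y⁺` is at least as long as the
distance to `y` if it starts in `V⁺`; if it starts at `z⁻`, it is at least as long as some
path of the form `z⁻, …, w⁻, v⁺, …, y⁺` with a single crossing. -/
theorem CondI.le_walk_length {V : Type*} {G : SimpleGraph V} {D : ℕ} (hconn : G.Connected)
    (hI : CondI G D) {y : V} {u t : V ⊕ V} (p : (doubling G D).Walk u t)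
    (ht : t = Sum.inl y) :
    (∀ x, u = Sum.inl x → G.dist x y ≤ p.length) ∧
      ∀ z, u = Sum.inr z → ∃ w v, G.dist v w = D ∧ G.dist z w + 1 + G.dist v y ≤ p.length := by
  induction p with
  | nil => subst ht; simp
  | @cons u b t h p ih =>
    obtain ⟨ihl, ihr⟩ := ih ht
    rw [SimpleGraph.Walk.length_cons]
    refine ⟨?_, ?_⟩
    · rintro x rfl
      rcases b with b | b
      · have hb := SimpleGraph.dist_eq_one_iff_adj.2 (doubling_adj_inl_inl.1 h)
        have := ihl b rfl
        have := hconn.dist_triangle (u := x) (v := b) (w := y)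
        omega
      · obtain ⟨w, v, hvw, hle⟩ := ihr b rfl
        have := hI x v b w (doubling_adj_inl_inr.1 h) hvw
        have := hconn.dist_triangle (u := x) (v := v) (w := y)
        omega
    · rintro z rfl
      rcases b with b | b
      · refine ⟨z, b, doubling_adj_inr_inl.1 h, ?_⟩
        have := ihl b rfl
        rw [SimpleGraph.dist_self]
        omega
      · obtain ⟨w, v, hvw, hle⟩ := ihr b rfl
        refine ⟨w, v, hvw, ?_⟩
        have hb := SimpleGraph.dist_eq_one_iff_adj.2 (doubling_adj_inr_inr.1 h)
        have := hconn.dist_triangle (u := z) (v := b) (w := w)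
        omega

/-- The natural copy of `Γ` inside its diametral doubling `□Γ` is isometric if and
only if condition (I) holds. -/
theorem doubling_isometric_iff_condI {V : Type*} [Fintype V] (G : SimpleGraph V)
    (hconn : G.Connected) (hcard : 2 ≤ Fintype.card V) (D : ℕ)
    (hD1 : ∀ x y : V, G.dist x y ≤ D) (hD2 : ∃ x y : V, G.dist x y = D) :
    (∀ x y : V, (doubling G D).dist (Sum.inl x) (Sum.inl y) = G.dist x y) ↔
      CondI G D := by
  constructor
  · intro h x y z₁ z₂ hx hy
    obtain ⟨p, hp⟩ := hconn.exists_walk_length_eq_dist z₁ z₂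
    have hz : (doubling G D).Adj (Sum.inl x) (doublingInr G D z₁) := doubling_adj_inl_inr.2 hx
    have hz' : (doubling G D).Adj (doublingInr G D z₂) (Sum.inl y) := doubling_adj_inr_inl.2 hy
    have := SimpleGraph.dist_le (SimpleGraph.Walk.cons hz ((p.map (doublingInr G D)).concat hz'))
    rw [h, SimpleGraph.Walk.length_cons, SimpleGraph.Walk.length_concat,
      SimpleGraph.Walk.length_map] at this
    omega
  · intro hI x y
    obtain ⟨p, hp⟩ := hconn.exists_walk_length_eq_dist x y
    let q : (doubling G D).Walk (Sum.inl x) (Sum.inl y) := p.map (doublingInl G D)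
    apply le_antisymm
    · rw [← hp, ← SimpleGraph.Walk.length_map (doublingInl G D) p]
      exact SimpleGraph.dist_le q
    · obtain ⟨r, hr⟩ := q.reachable.exists_walk_length_eq_dist
      rw [← hr]
      exact (hI.le_walk_length hconn r rfl).1 x rfl
end

section
/- Let Γ be a finite connected simple graph with at least 2 vertices and diameter D satisfying condition (I). Then the following are equivalent: (a) for all vertices x, y of Γ, d_{□Γ}(x⁺, y⁻) = D + 1 − d_Γ(x,y); (b) condition (II) holds: every pair of vertices lies on a geodesic of length D, i.e., for all vertices x, y there exist vertices z₁, z₂ with d_Γ(z₁,z₂) = D and d_Γ(z₁,x) + d_Γ(x,y) + d_Γ(y,z₂) = D. -/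
namespace doubling

variable {V : Type*} {G : SimpleGraph V} {D : ℕ}

@[simp]
lemma adj_inl_inl {x y : V} : (doubling G D).Adj (Sum.inl x) (Sum.inl y) ↔ G.Adj x y := by
  simpa [doubling, G.adj_comm y x] using SimpleGraph.Adj.ne

@[simp]
lemma adj_inr_inr {x y : V} : (doubling G D).Adj (Sum.inr x) (Sum.inr y) ↔ G.Adj x y := by
  simpa [doubling, G.adj_comm y x] using SimpleGraph.Adj.ne

@[simp]
lemma adj_inl_inr {x y : V} :
    (doubling G D).Adj (Sum.inl x) (Sum.inr y) ↔ G.dist x y = D := by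
  simp [doubling]

@[simp]
lemma adj_inr_inl {x y : V} :
    (doubling G D).Adj (Sum.inr x) (Sum.inl y) ↔ G.dist x y = D := by
  simp [doubling, G.dist_comm (u := y)]

/-- The inclusion of the first copy of the graph into its diametral doubling. -/
def inlHom (G : SimpleGraph V) (D : ℕ) : G →g doubling G D where
  toFun := Sum.inl
  map_rel' := adj_inl_inl.2

/-- The inclusion of the second copy of the graph into its diametral doubling. -/
def inrHom (G : SimpleGraph V) (D : ℕ) : G →g doubling G D where
  toFun := Sum.inr
  map_rel' := adj_inr_inr.2

lemma exists_walk_inl_inr (hconn : G.Connected) {z₁ z₂ : V} (hz : G.dist z₁ z₂ = D) (x y : V) :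
    ∃ p : (doubling G D).Walk (Sum.inl x) (Sum.inr y),
      p.length = G.dist x z₁ + 1 + G.dist z₂ y := by
  obtain ⟨p, hp⟩ := hconn.exists_walk_length_eq_dist x z₁
  obtain ⟨q, hq⟩ := hconn.exists_walk_length_eq_dist z₂ y
  have hadj : (doubling G D).Adj (inlHom G D z₁) (inrHom G D z₂) := adj_inl_inr.2 hz
  let r := (p.map (inlHom G D)).append (.cons hadj (q.map (inrHom G D)))
  have hr : r.length = G.dist x z₁ + 1 + G.dist z₂ y := by
    rw [SimpleGraph.Walk.length_append, SimpleGraph.Walk.length_cons,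
      SimpleGraph.Walk.length_map, SimpleGraph.Walk.length_map]
    omega
  exact ⟨r, hr⟩

/-- The lower bound on the length of a walk in the doubling between given end vertices:
the distance in the graph if they are in the same copy, and the length of a walk crossing
exactly once otherwise. -/
def LengthBound (G : SimpleGraph V) (D : ℕ) (n : ℕ) : V ⊕ V → V ⊕ V → Prop
  | Sum.inl x, Sum.inl y => G.dist x y ≤ n
  | Sum.inr x, Sum.inr y => G.dist x y ≤ n
  | Sum.inl x, Sum.inr y => ∃ z₁ z₂, G.dist z₁ z₂ = D ∧ G.dist x z₁ + 1 + G.dist z₂ y ≤ n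
  | Sum.inr x, Sum.inl y => ∃ z₁ z₂, G.dist z₁ z₂ = D ∧ G.dist x z₁ + 1 + G.dist z₂ y ≤ n

lemma dist_le_of_cross_twice (hconn : G.Connected) (hI : CondI G D) {x x' y z₁ z₂ : V}
    (hx : G.dist x x' = D) (hz : G.dist z₁ z₂ = D) :
    G.dist x y ≤ G.dist x' z₁ + 1 + G.dist z₂ y + 1 := by
  have h := hI x z₂ x' z₁ hx (G.dist_comm.trans hz)
  have := hconn.dist_triangle (u := x) (v := z₂) (w := y)
  omega

lemma lengthBound_of_walk (hconn : G.Connected) (hI : CondI G D) {u w : V ⊕ V}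
    (p : (doubling G D).Walk u w) : LengthBound G D p.length u w := by
  induction p with
  | @nil u => cases u <;> simp [LengthBound]
  | @cons u v w h p ih =>
    rw [SimpleGraph.Walk.length_cons]
    have step {x x' : V} (hx : G.Adj x x') (y : V) : G.dist x y ≤ G.dist x' y + 1 := by
      have := hconn.dist_triangle (u := x) (v := x') (w := y)
      have := SimpleGraph.dist_eq_one_iff_adj.2 hx
      omega
    have cross {x x' y : V} (hx : G.dist x x' = D) (hy : G.dist x' y ≤ p.length) :
        ∃ z₁ z₂, G.dist z₁ z₂ = D ∧ G.dist x z₁ + 1 + G.dist z₂ y ≤ p.length + 1 :=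
      ⟨x, x', hx, by rw [SimpleGraph.dist_self]; omega⟩
    rcases u with x | x <;> rcases v with x' | x' <;> rcases w with y | y <;>
      simp only [LengthBound, adj_inl_inl, adj_inr_inr, adj_inl_inr, adj_inr_inl] at h ih ⊢
    case inl.inl.inl | inr.inr.inr => exact (step h y).trans (by omega)
    case inl.inl.inr | inr.inr.inl =>
      obtain ⟨z₁, z₂, hz, hle⟩ := ih
      exact ⟨z₁, z₂, hz, by have := step h z₁; omega⟩
    case inl.inr.inr | inr.inl.inl => exact cross h ih
    case inl.inr.inl | inr.inl.inr =>
      obtain ⟨z₁, z₂, hz, hle⟩ := ih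
      exact (dist_le_of_cross_twice hconn hI h hz).trans (by omega)

lemma exists_le_dist_inl_inr (hconn : G.Connected) (hI : CondI G D) {x y : V}
    (hxy : (doubling G D).Reachable (Sum.inl x) (Sum.inr y)) :
    ∃ z₁ z₂, G.dist z₁ z₂ = D ∧
      G.dist x z₁ + 1 + G.dist z₂ y ≤ (doubling G D).dist (Sum.inl x) (Sum.inr y) := by
  obtain ⟨p, hp⟩ := hxy.exists_walk_length_eq_dist
  exact hp ▸ lengthBound_of_walk hconn hI p

end doubling

/-- Given condition (I), the cross-distances in the diametral doubling satisfy
`d_{□Γ}(x⁺, y⁻) = D + 1 − d_Γ(x,y)` for all `x, y` if and only if condition (II)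
holds, i.e. every geodesic lies on a geodesic of length `D`. -/
theorem doubling_cross_dist_iff_condII {V : Type*} [Fintype V] (G : SimpleGraph V)
    (hconn : G.Connected) (hcard : 2 ≤ Fintype.card V) (D : ℕ)
    (hD1 : ∀ x y : V, G.dist x y ≤ D) (hD2 : ∃ x y : V, G.dist x y = D)
    (hI : CondI G D) :
    (∀ x y : V, (doubling G D).dist (Sum.inl x) (Sum.inr y) = D + 1 - G.dist x y) ↔
      CondII G D := by
  have triangle (x y z₁ z₂ : V) :
      G.dist z₁ z₂ ≤ G.dist z₁ x + G.dist x y + G.dist y z₂ := by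
    have := hconn.dist_triangle (u := z₁) (v := x) (w := z₂)
    have := hconn.dist_triangle (u := x) (v := y) (w := z₂)
    omega
  constructor <;> intro h x y
  · obtain ⟨a, b, hab⟩ := hD2
    obtain ⟨p, -⟩ := doubling.exists_walk_inl_inr hconn hab x y
    obtain ⟨z₁, z₂, hz, hle⟩ := doubling.exists_le_dist_inl_inr hconn hI p.reachable
    refine ⟨z₁, z₂, hz, ?_⟩
    have := triangle x y z₁ z₂
    have := hD1 x y
    rw [h x y, G.dist_comm (u := x) (v := z₁), G.dist_comm (u := z₂)] at hle
    omega
  · obtain ⟨z₁, z₂, hz, hgeod⟩ := h x y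
    obtain ⟨p, hp⟩ := doubling.exists_walk_inl_inr hconn hz x y
    have hupper := SimpleGraph.dist_le p
    obtain ⟨w₁, w₂, hw, hlower⟩ := doubling.exists_le_dist_inl_inr hconn hI p.reachable
    have := triangle x y w₁ w₂
    rw [G.dist_comm (u := x) (v := w₁), G.dist_comm (u := w₂)] at hlower
    rw [G.dist_comm (u := x) (v := z₁), G.dist_comm (u := z₂)] at hp
    omega
end
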